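/- Let R(t) = t² + t³. There is no Möbius transformation m(t) = (αt + β)/(γt + δ) with αδ − βγ ≠ 0 and no integer d ≥ 2 such that, as rational functions, R(m(t)) = m(t^d), or R(m(t)) = m(T_d(t)), or R(m(t)) = m(−T_d(t)), where T_d is the d-th Chebyshev polynomial of the first kind (defined by T_d(cos θ) = cos(dθ)). Consequently, the iterative functional equation y(t) = t + y(t²+t³) of complete {2,3}-trees cannot be reduced to a Mahler equation via a rational conjugation. -/

import Mathlib

noncomputable section

open Polynomial

/-- For coprime `A²(A+B)` and `B³`, the polynomial identity obtained by clearing denominators in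
`R(m(t)) = m(p(t))` identifies numerators with numerators and denominators with denominators. -/
lemma associated_of_conjugation {α β γ δ : ℂ} (h : α * δ - β * γ ≠ 0) {p : ℂ[X]}
    (hp : (C α * X + C β) ^ 2 * ((C α * X + C β) + (C γ * X + C δ)) * (C γ * p + C δ) =
      (C γ * X + C δ) ^ 3 * (C α * p + C β)) :
    Associated (C γ * p + C δ) ((C γ * X + C δ) ^ 3) ∧
      Associated (C α * p + C β)
        ((C α * X + C β) ^ 2 * ((C α * X + C β) + (C γ * X + C δ))) := by
  have hcop (q : ℂ[X]) : IsCoprime (C α * q + C β) (C γ * q + C δ) := by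
    have hC : C (α * δ - β * γ)⁻¹ * (C α * C δ - C β * C γ) = (1 : ℂ[X]) := by
      rw [← C_mul, ← C_mul, ← C_sub, ← C_mul, inv_mul_cancel₀ h, C_1]
    exact ⟨-C (α * δ - β * γ)⁻¹ * C γ, C (α * δ - β * γ)⁻¹ * C α, by linear_combination hC⟩
  have hX := hcop X
  have hsum : IsCoprime ((C α * X + C β) + (C γ * X + C δ)) (C γ * X + C δ) := by
    simpa using hX.add_mul_left_left 1
  have hAB : IsCoprime ((C α * X + C β) ^ 2 * ((C α * X + C β) + (C γ * X + C δ)))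
      ((C γ * X + C δ) ^ 3) := (hX.pow_left.mul_left hsum).pow_right
  refine ⟨associated_of_dvd_dvd ?_ ?_, associated_of_dvd_dvd ?_ ?_⟩
  · exact (hcop p).symm.dvd_of_dvd_mul_right (Dvd.intro_left _ hp)
  · exact hAB.symm.dvd_of_dvd_mul_left (Dvd.intro _ hp.symm)
  · exact (hcop p).dvd_of_dvd_mul_right (Dvd.intro_left _ hp.symm)
  · exact hAB.dvd_of_dvd_mul_left (Dvd.intro _ hp)

/-- A polynomial conjugate to `t² + t³` by a Möbius transformation has degree `3`. -/
lemma natDegree_eq_three_of_conjugation {α β γ δ : ℂ} (h : α * δ - β * γ ≠ 0) {p : ℂ[X]}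
    (hp : (C α * X + C β) ^ 2 * ((C α * X + C β) + (C γ * X + C δ)) * (C γ * p + C δ) =
      (C γ * X + C δ) ^ 3 * (C α * p + C β)) : p.natDegree = 3 := by
  obtain ⟨h₁, h₂⟩ := associated_of_conjugation h hp
  by_cases hγ : γ = 0
  · subst hγ
    have hα : α ≠ 0 := by rintro rfl; simp at h
    have key := natDegree_eq_of_degree_eq (degree_eq_degree_of_associated h₂)
    have e : C α * X + C β + (C 0 * X + C δ) = C α * X + C (β + δ) := by
      simp only [C_add, C_0]; ring
    rw [natDegree_add_C, natDegree_C_mul hα, e, natDegree_mul, natDegree_pow,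
      natDegree_linear hα, natDegree_linear hα] at key
    · exact key
    · exact pow_ne_zero _ (ne_zero_of_natDegree_gt (n := 0) (by rw [natDegree_linear hα]; simp))
    · exact ne_zero_of_natDegree_gt (n := 0) (by rw [natDegree_linear hα]; simp)
  · have key := natDegree_eq_of_degree_eq (degree_eq_degree_of_associated h₁)
    rwa [natDegree_add_C, natDegree_C_mul hγ, natDegree_pow, natDegree_linear hγ] at key

/-- No odd cubic polynomial is conjugate to `t² + t³` by a Möbius transformation. -/
lemma not_conjugate_odd_cubic {α β γ δ a b : ℂ} (h : α * δ - β * γ ≠ 0) (ha : a ≠ 0)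
    (hp : (C α * X + C β) ^ 2 * ((C α * X + C β) + (C γ * X + C δ)) *
        (C γ * (C a * X ^ 3 + C b * X) + C δ) =
      (C γ * X + C δ) ^ 3 * (C α * (C a * X ^ 3 + C b * X) + C β)) : False := by
  obtain ⟨h₁, -⟩ := associated_of_conjugation h hp
  have ev (x : ℂ) := congrArg (eval x) hp
  simp only [eval_add, eval_mul, eval_pow, eval_C, eval_X] at ev
  by_cases hγ : γ = 0
  · subst hγ
    have hα : α ≠ 0 := by rintro rfl; simp at h
    have hδ : δ ≠ 0 := by rintro rfl; simp at h
    have e0 := ev 0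
    have e1 := ev 1
    have e2 := ev (-1)
    have h3 : (α ^ 2 * δ) * (δ + 3 * β) = 0 := by linear_combination (e1 + e2) / 2 - e0
    have h4 : δ = -3 * β := by
      have := (mul_eq_zero.1 h3).resolve_left (by positivity)
      linear_combination this
    subst h4
    have h5 : β ^ 4 = 0 := by linear_combination e0 / 33
    exact hδ (by simp [pow_eq_zero_iff (four_ne_zero) |>.1 h5])
  · obtain ⟨v, hv⟩ := h₁.symm
    obtain ⟨u, hu, huv⟩ := Polynomial.isUnit_iff.1 v.isUnit
    rw [← huv] at hv
    have eu (x : ℂ) := congrArg (eval x) hv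
    simp only [eval_add, eval_mul, eval_pow, eval_C, eval_X] at eu
    have hδ : δ = 0 := by
      have : (3 * u * γ ^ 2) * δ = 0 := by
        linear_combination (eu 1 + eu (-1)) / 2 - eu 0
      exact (mul_eq_zero.1 this).resolve_left
        (mul_ne_zero (mul_ne_zero three_ne_zero hu.ne_zero) (pow_ne_zero _ hγ))
    subst hδ
    have hβ : β ≠ 0 := by rintro rfl; simp at h
    have hb : b = 0 := by
      have : γ * b = 0 := by linear_combination (eu 2 - 8 * eu 1) / 6
      exact (mul_eq_zero.1 this).resolve_left hγ
    subst hb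
    have e1 := ev 1
    have e2 := ev (-1)
    have e3 := ev 2
    have e4 := ev (-2)
    have c1 : (γ * a * β ^ 2) * (3 * α + γ) = 0 := by
      linear_combination (2 / 3 : ℂ) * (e1 + e2) - (1 / 96 : ℂ) * (e3 + e4)
    have c2 : (γ * a * β) * (α * (3 * α + 2 * γ)) = 0 := by
      linear_combination (e3 - e4) / 48 - (e1 - e2) / 6
    have c1' := (mul_eq_zero.1 c1).resolve_left
      (mul_ne_zero (mul_ne_zero hγ ha) (pow_ne_zero _ hβ))
    have c2' := (mul_eq_zero.1 c2).resolve_left (mul_ne_zero (mul_ne_zero hγ ha) hβ)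
    have : γ ^ 2 = 0 := by linear_combination (3 * α + γ) * c1' - 3 * c2'
    exact hγ (pow_eq_zero_iff two_ne_zero |>.1 this)

/-- Clearing denominators in `R(m(t)) = m(p(t))`. -/
lemma conjugation_clear_denominators {α β γ δ : ℂ} (h : α * δ - β * γ ≠ 0) {p : ℂ[X]}
    (hd : 2 ≤ p.natDegree)
    (hp : (algebraMap ℂ[X] (RatFunc ℂ) (C α * X + C β) /
          algebraMap ℂ[X] (RatFunc ℂ) (C γ * X + C δ)) ^ 2 +
        (algebraMap ℂ[X] (RatFunc ℂ) (C α * X + C β) /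
          algebraMap ℂ[X] (RatFunc ℂ) (C γ * X + C δ)) ^ 3 =
        algebraMap ℂ[X] (RatFunc ℂ) (C α * p + C β) /
          algebraMap ℂ[X] (RatFunc ℂ) (C γ * p + C δ)) :
    (C α * X + C β) ^ 2 * ((C α * X + C β) + (C γ * X + C δ)) * (C γ * p + C δ) =
      (C γ * X + C δ) ^ 3 * (C α * p + C β) := by
  have hne (q : ℂ[X]) (hq : 0 < q.natDegree) : C γ * q + C δ ≠ 0 := by
    by_cases hγ : γ = 0
    · subst hγ
      have hδ : δ ≠ 0 := by rintro rfl; simp at h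
      simpa using hδ
    · refine ne_zero_of_natDegree_gt (n := 0) ?_
      rwa [natDegree_add_C, natDegree_C_mul hγ]
  have hX := RatFunc.algebraMap_ne_zero (hne X (by simp))
  have hP := RatFunc.algebraMap_ne_zero (hne p (by omega))
  apply RatFunc.algebraMap_injective ℂ
  simp only [map_mul (algebraMap ℂ[X] (RatFunc ℂ)) (_ * _) (_ + _),
    map_mul (algebraMap ℂ[X] (RatFunc ℂ)) (_ ^ _) (_ + _), map_pow,
    map_add (algebraMap ℂ[X] (RatFunc ℂ)) (_ + _) (_ + _)]
  generalize algebraMap ℂ[X] (RatFunc ℂ) (C α * X + C β) = A at *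
  generalize algebraMap ℂ[X] (RatFunc ℂ) (C γ * X + C δ) = B at *
  generalize algebraMap ℂ[X] (RatFunc ℂ) (C α * p + C β) = P at *
  generalize algebraMap ℂ[X] (RatFunc ℂ) (C γ * p + C δ) = Q at *
  field_simp at hp
  linear_combination hp

/-- **Proposition (novelty).** For `R(t) = t² + t³` there is no Möbius transformation
`m(t) = (αt + β)/(γt + δ)` (with `αδ − βγ ≠ 0`) and no `d ≥ 2` such that, as rational
functions, `R(m(t)) = m(t^d)`, or `R(m(t)) = m(T_d(t))`, or `R(m(t)) = m(−T_d(t))`, where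
`T_d` is the `d`-th Chebyshev polynomial of the first kind.  Since `R(t) = t² + t³`, the
composition `R(m(t))` is the rational function `m² + m³`, and `m(p(t))` for a polynomial `p`
is `(α·p + β)/(γ·p + δ)`.  Consequently the iterative equation of complete {2,3}-trees
cannot be reduced to a Mahler equation by a rational conjugation. -/
theorem main18 :
    ¬ ∃ (α β γ δ : ℂ) (d : ℕ), α * δ - β * γ ≠ 0 ∧ 2 ≤ d ∧
      (let m : RatFunc ℂ :=
        algebraMap (Polynomial ℂ) (RatFunc ℂ) (C α * X + C β) /
          algebraMap (Polynomial ℂ) (RatFunc ℂ) (C γ * X + C δ)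
       let mOf : Polynomial ℂ → RatFunc ℂ := fun p =>
        algebraMap (Polynomial ℂ) (RatFunc ℂ) (C α * p + C β) /
          algebraMap (Polynomial ℂ) (RatFunc ℂ) (C γ * p + C δ)
       m ^ 2 + m ^ 3 = mOf (X ^ d) ∨
        m ^ 2 + m ^ 3 = mOf (Polynomial.Chebyshev.T ℂ d) ∨
        m ^ 2 + m ^ 3 = mOf (-Polynomial.Chebyshev.T ℂ d)) := by
  rintro ⟨α, β, γ, δ, d, h, hd, H⟩
  have hT : (Chebyshev.T ℂ d).natDegree = d := by simp [Chebyshev.natDegree_T]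
  have hT3 : Chebyshev.T ℂ 3 = C 4 * X ^ 3 + C (-3) * X := by
    rw [show (3 : ℤ) = 1 + 2 by rfl, Chebyshev.T_add_two, show (1 + 1 : ℤ) = 2 by rfl,
      Chebyshev.T_two, Chebyshev.T_one, C_neg, C_ofNat, C_ofNat]
    ring
  rcases H with H | H | H
  · have hp := conjugation_clear_denominators h (by simpa using hd) H
    have h3 := natDegree_eq_three_of_conjugation h hp
    rw [natDegree_X_pow] at h3
    subst h3
    exact not_conjugate_odd_cubic (a := 1) (b := 0) h one_ne_zero (by simpa using hp)
  · have hp := conjugation_clear_denominators h (by rwa [hT]) H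
    have h3 := natDegree_eq_three_of_conjugation h hp
    rw [hT] at h3
    subst h3
    rw [Nat.cast_ofNat, hT3] at hp
    exact not_conjugate_odd_cubic h (by norm_num) hp
  · have hp := conjugation_clear_denominators h (by rwa [natDegree_neg, hT]) H
    have h3 := natDegree_eq_three_of_conjugation h hp
    rw [natDegree_neg, hT] at h3
    subst h3
    have hneg : -(C 4 * X ^ 3 + C (-3) * X) = (C (-4) * X ^ 3 + C 3 * X : ℂ[X]) := by
      simp only [C_neg]; ring
    rw [Nat.cast_ofNat, hT3, hneg] at hp
    exact not_conjugate_odd_cubic h (by norm_num) hp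

end
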